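/- arXiv:1301.7024 — 2 statements merged into one kernel-verified Lean document; each statement's English description precedes it below -/
import Mathlib

section
/- Let x be an irrational real number, k ≥ 2 an integer, and B a Γ₁-equivalence class in 𝒬 (Γ₁ = PSL₂(ℤ)). Then Σ_{Q ∈ B⟨x⟩} Q(x)^{k−1} = Σ_{Q ∈ B^Sim} Σ_{γ ∈ Γ₁(x), Q(γ(x)) > 0, Q(γ(∞)) < 0} (Q|γ)(x)^{k−1}. -/
open Polynomial Matrix

noncomputable section

abbrev Mat2 := Matrix (Fin 2) (Fin 2) ℤ

/-- The matrix `Tⁿ = [[1,n],[0,1]]`. -/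
def Tpow (n : ℤ) : Mat2 := !![1, n; 0, 1]

/-- The matrix `ε = [[0,1],[1,0]]`. -/
def Meps : Mat2 := !![0, 1; 1, 0]

/-- The matrix `S = [[0,-1],[1,0]]`. -/
def MS : Mat2 := !![0, -1; 1, 0]

/-- The matrix `T = [[1,1],[0,1]]`. -/
def MT : Mat2 := !![1, 1; 0, 1]

/-- The matrix `σ = [[-1,0],[0,1]]`. -/
def Msig : Mat2 := !![-1, 0; 0, 1]

/-- The matrix `U = TS = [[1,-1],[1,0]]`. -/
def MU : Mat2 := MT * MS

/-- Möbius action of an integer matrix on a real number. -/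
def moeb (M : Mat2) (x : ℝ) : ℝ :=
  ((M 0 0 : ℝ) * x + (M 0 1 : ℝ)) / ((M 1 0 : ℝ) * x + (M 1 1 : ℝ))

/-- The sequence `x_i` of the (positive) continued fraction algorithm:
`x_0 = x`, `x_{i+1} = 1/(x_i - ⌊x_i⌋)`. -/
def cfX (x : ℝ) : ℕ → ℝ
  | 0 => x
  | i + 1 => 1 / (cfX x i - (⌊cfX x i⌋ : ℝ))

/-- The partial quotients `n_i = ⌊x_i⌋` of the continued fraction of `x`. -/
def cfN (x : ℝ) (i : ℕ) : ℤ := ⌊cfX x i⌋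

/-- The matrices `γ_0 = Id`, `γ_{i+1} = ε T^{-n_i} γ_i`. -/
def gam (x : ℝ) : ℕ → Mat2
  | 0 => 1
  | i + 1 => (Meps * Tpow (-(cfN x i))) * gam x i

/-- `Γ(x) = {γ_1, γ_2, γ_3, …}`. -/
def GammaSet (x : ℝ) : Set Mat2 := {M | ∃ i, 1 ≤ i ∧ M = gam x i}

/-- The matrices `γ'_0 = Id`, `γ'_{i+1} = Tγ'_i` if `γ'_i(x) ≤ 0`,
`T^{-1}εγ'_i` if `0 < γ'_i(x) ≤ 1`, and `T^{-1}γ'_i` if `γ'_i(x) > 1`. -/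
def gam' (x : ℝ) : ℕ → Mat2
  | 0 => 1
  | i + 1 =>
    if moeb (gam' x i) x ≤ 0 then MT * gam' x i
    else if moeb (gam' x i) x ≤ 1 then (Tpow (-1) * Meps) * gam' x i
    else Tpow (-1) * gam' x i

/-- `Γ(x)' = {γ'_1, γ'_2, γ'_3, …}`. -/
def GammaSet' (x : ℝ) : Set Mat2 := {M | ∃ i, 1 ≤ i ∧ M = gam' x i}

/-- The sequence `x_i` of the negative continued fraction algorithm:
`x_0 = x`, `x_{i+1} = 1/(⌈x_i⌉ - x_i)`. -/
def ncfX (x : ℝ) : ℕ → ℝ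
  | 0 => x
  | i + 1 => 1 / ((⌈ncfX x i⌉ : ℝ) - ncfX x i)

/-- The partial quotients `m_i = ⌈x_i⌉` of the negative continued fraction of `x`. -/
def ncfM (x : ℝ) (i : ℕ) : ℤ := ⌈ncfX x i⌉

/-- The matrices `γ̃_0 = Id`, `γ̃_{i+1} = S T^{-m_i} γ̃_i`. -/
def gamt (x : ℝ) : ℕ → Mat2
  | 0 => 1
  | i + 1 => (MS * Tpow (-(ncfM x i))) * gamt x i

/-- `Γ₁(x) = {γ̃_1, γ̃_2, γ̃_3, …}`. -/
def Gamma1Set (x : ℝ) : Set Mat2 := {M | ∃ i, 1 ≤ i ∧ M = gamt x i}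

/-- A binary quadratic polynomial `aX² + bX + c`, encoded as the triple `(a,b,c)`. -/
abbrev QF := ℤ × ℤ × ℤ

/-- The value of `aX² + bX + c` at a real number `x`. -/
def Qval (q : QF) (x : ℝ) : ℝ := (q.1 : ℝ) * x ^ 2 + (q.2.1 : ℝ) * x + (q.2.2 : ℝ)

/-- The value of `aX² + bX + c` at an integer `m`. -/
def QvalZ (q : QF) (m : ℤ) : ℤ := q.1 * m ^ 2 + q.2.1 * m + q.2.2

/-- The discriminant `b² - 4ac`. -/
def Qdisc (q : QF) : ℤ := q.2.1 ^ 2 - 4 * q.1 * q.2.2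

/-- The homogenized value `a r² + b r t + c t²`; for `t ≠ 0` its sign is that of `Q(r/t)`,
and for `t = 0` that of the leading coefficient, i.e. of `Q(∞)`. -/
def Qhom (q : QF) (r t : ℤ) : ℤ := q.1 * r ^ 2 + q.2.1 * r * t + q.2.2 * t ^ 2

/-- The weight 2 action `(Q|γ)(X) = (tX+u)² Q((rX+s)/(tX+u))` on quadratic polynomials,
for `γ = [[r,s],[t,u]]`. -/
def qslash (M : Mat2) (q : QF) : QF :=
  (Qhom q (M 0 0) (M 1 0),
   2 * q.1 * M 0 0 * M 0 1 + q.2.1 * (M 0 0 * M 1 1 + M 0 1 * M 1 0) + 2 * q.2.2 * M 1 0 * M 1 1,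
   Qhom q (M 0 1) (M 1 1))

/-- The set `𝒬` of integral quadratic polynomials with positive non-square discriminant. -/
def Qset : Set QF := {q | 0 < Qdisc q ∧ ¬ IsSquare (Qdisc q)}

/-- `A` is a `Γ`-equivalence class in `𝒬`, where `Γ = PGL₂(ℤ)`. -/
def IsClassQ (A : Set QF) : Prop :=
  ∃ q₀ ∈ Qset, A = {q ∈ Qset | ∃ M : Mat2, IsUnit M.det ∧ q = qslash M q₀}

/-- `B` is a `Γ₁`-equivalence class in `𝒬`, where `Γ₁ = PSL₂(ℤ)`. -/
def IsClassQ1 (B : Set QF) : Prop :=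
  ∃ q₀ ∈ Qset, B = {q ∈ Qset | ∃ M : Mat2, M.det = 1 ∧ q = qslash M q₀}

/-- `A^Sim = {Q ∈ A : Q(0) < 0 < Q(∞)}`. -/
def QSim (A : Set QF) : Set QF := {q ∈ A | q.2.2 < 0 ∧ 0 < q.1}

/-- `A^Red = {Q ∈ A : Q(∞) > 0, Q(-1) < 0 < Q(0)}`. -/
def QRed (A : Set QF) : Set QF := {q ∈ A | 0 < q.1 ∧ q.1 - q.2.1 + q.2.2 < 0 ∧ 0 < q.2.2}

/-- `A⟨x⟩ = {Q ∈ A : Q(∞) < 0 < Q(x)}`. -/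
def QxSet (A : Set QF) (x : ℝ) : Set QF := {q ∈ A | q.1 < 0 ∧ 0 < Qval q x}

/-- `𝒬_D⟨x⟩`, the set of quadratics of discriminant `D` with `Q(∞) < 0 < Q(x)`. -/
def QDx (D : ℕ) (x : ℝ) : Set QF :=
  {q | Qdisc q = (D : ℤ) ∧ q.1 < 0 ∧ 0 < Qval q x}

/-- The simple forms of discriminant `D`: `a > 0 > c`. -/
def SimpleD (D : ℕ) : Set QF := {q | Qdisc q = (D : ℤ) ∧ 0 < q.1 ∧ q.2.2 < 0}

/-- The reduced forms of discriminant `D`: `a > 0`, `c > 0`, `b > a + c`. -/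
def ReducedD (D : ℕ) : Set QF :=
  {q | Qdisc q = (D : ℤ) ∧ 0 < q.1 ∧ 0 < q.2.2 ∧ q.1 + q.2.2 < q.2.1}

/-- Homogenized evaluation of a polynomial of degree ≤ d: `∑ P_j r^j t^{d-j}`;
for `t ≠ 0` its sign is that of `P(r/t)` (`d` even), and for `t = 0` that of `P(∞)`. -/
def homEval (d : ℕ) (P : Polynomial ℤ) (r t : ℤ) : ℤ :=
  ∑ j ∈ Finset.range (d + 1), P.coeff j * r ^ j * t ^ (d - j)

/-- The weight `d` action `(P|γ)(X) = (tX+u)^d P((rX+s)/(tX+u))` on integral polynomials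
of degree at most `d`, for `γ = [[r,s],[t,u]]`. -/
def pslash (d : ℕ) (M : Mat2) (P : Polynomial ℤ) : Polynomial ℤ :=
  ∑ j ∈ Finset.range (d + 1),
    C (P.coeff j) * (C (M 0 0) * X + C (M 0 1)) ^ j * (C (M 1 0) * X + C (M 1 1)) ^ (d - j)

/-- `P` has exactly two real roots `w ≠ w'`, both irrational. -/
def HasTwoIrratRoots (P : Polynomial ℤ) (w w' : ℝ) : Prop :=
  w ≠ w' ∧ Irrational w ∧ Irrational w' ∧ ∀ y : ℝ, Polynomial.aeval y P = 0 ↔ y = w ∨ y = w'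

/-- `F_d`: integral polynomials of degree ≤ d with exactly two real roots, both irrational. -/
def Fd (d : ℕ) : Set (Polynomial ℤ) :=
  {P | P.natDegree ≤ d ∧ ∃ w w' : ℝ, HasTwoIrratRoots P w w'}

/-- `A` is a `Γ`-equivalence class in `F_d`, where `Γ = PGL₂(ℤ)`. -/
def IsClassF (d : ℕ) (A : Set (Polynomial ℤ)) : Prop :=
  ∃ P₀ ∈ Fd d, A = {P ∈ Fd d | ∃ M : Mat2, IsUnit M.det ∧ P = pslash d M P₀}

/-- `B` is a `Γ₁`-equivalence class in `F_d`, where `Γ₁ = PSL₂(ℤ)`. -/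
def IsClassF1 (d : ℕ) (B : Set (Polynomial ℤ)) : Prop :=
  ∃ P₀ ∈ Fd d, B = {P ∈ Fd d | ∃ M : Mat2, M.det = 1 ∧ P = pslash d M P₀}

/-- `A^Sim = {P ∈ A : P(0) < 0 < P(∞)}`, where `P(∞)` is the coefficient of `X^d`. -/
def PSim (d : ℕ) (A : Set (Polynomial ℤ)) : Set (Polynomial ℤ) :=
  {P ∈ A | P.coeff 0 < 0 ∧ 0 < P.coeff d}

/-- `A^Red = {P ∈ A : P(∞) > 0 and P(-1) < 0 < P(0)}`. -/
def PRed (d : ℕ) (A : Set (Polynomial ℤ)) : Set (Polynomial ℤ) :=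
  {P ∈ A | 0 < P.coeff d ∧ Polynomial.aeval (-1 : ℤ) P < 0 ∧ 0 < P.coeff 0}

/-- `A⟨x⟩ = {P ∈ A : P(∞) < 0 < P(x)}`. -/
def Px (d : ℕ) (A : Set (Polynomial ℤ)) (x : ℝ) : Set (Polynomial ℤ) :=
  {P ∈ A | P.coeff d < 0 ∧ 0 < Polynomial.aeval x P}

/-- The numerators of the convergents, shifted by 2: `pconv x i = p_{i-2}`. -/
def pconv (x : ℝ) : ℕ → ℤ
  | 0 => 0
  | 1 => 1
  | i + 2 => cfN x i * pconv x (i + 1) + pconv x i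

/-- The denominators of the convergents, shifted by 2: `qconv x i = q_{i-2}`. -/
def qconv (x : ℝ) : ℕ → ℤ
  | 0 => 1
  | 1 => 0
  | i + 2 => cfN x i * qconv x (i + 1) + qconv x i

/-- `δ_i = (-1)^i (p_{i-1} - q_{i-1} x)` for `i ≥ 0`. -/
def cfDelta (x : ℝ) (i : ℕ) : ℝ :=
  (-1 : ℝ) ^ i * ((pconv x (i + 1) : ℝ) - (qconv x (i + 1) : ℝ) * x)

/-- The weight `d` action `(P|γ)(X) = (tX+u)^d P((rX+s)/(tX+u))` on complex polynomials
of degree at most `d`, for `γ = [[r,s],[t,u]]` with integer entries. -/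
def cslash (d : ℕ) (M : Mat2) (P : Polynomial ℂ) : Polynomial ℂ :=
  ∑ j ∈ Finset.range (d + 1),
    C (P.coeff j) * (C (M 0 0 : ℂ) * X + C (M 0 1 : ℂ)) ^ j *
      (C (M 1 0 : ℂ) * X + C (M 1 1 : ℂ)) ^ (d - j)

/-- `P^Γ(x) = ∑_{γ ∈ Γ(x)} (P|γ)(x)` for `P` of degree ≤ 2k. -/
def PGam (k : ℕ) (P : Polynomial ℂ) (x : ℝ) : ℂ :=
  ∑' γ : GammaSet x, Polynomial.eval (x : ℂ) (cslash (2 * k) γ.1 P)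

/-- Pairs `(Q,γ) ∈ B^Sim × Γ₁(x)` with `Q(γ(x)) > 0` and `Q(γ(∞)) < 0`. -/
def Sim1Pairs (B : Set QF) (x : ℝ) : Set (QF × Mat2) :=
  {pg | pg.1 ∈ QSim B ∧ pg.2 ∈ Gamma1Set x ∧
    0 < Qval pg.1 (moeb pg.2 x) ∧ Qhom pg.1 (pg.2 0 0) (pg.2 1 0) < 0}

lemma Qdisc_qslash (M : Mat2) (q : QF) : Qdisc (qslash M q) = M.det ^ 2 * Qdisc q := by
  simp only [Qdisc, qslash, Qhom, Matrix.det_fin_two]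
  ring

lemma qslash_qslash (M N : Mat2) (q : QF) : qslash M (qslash N q) = qslash (N * M) q := by
  simp only [qslash, Qhom, Matrix.mul_apply, Fin.sum_univ_two, Prod.mk.injEq]
  refine ⟨?_, ?_, ?_⟩ <;> ring

lemma qslash_one (q : QF) : qslash 1 q = q := by
  simp [qslash, Qhom]

lemma qslash_neg (M : Mat2) (q : QF) : qslash (-M) q = qslash M q := by
  simp [qslash, Qhom]

lemma Qval_qslash (M : Mat2) (q : QF) {x : ℝ} (h : (M 1 0 : ℝ) * x + M 1 1 ≠ 0) :
    Qval (qslash M q) x = ((M 1 0 : ℝ) * x + M 1 1) ^ 2 * Qval q (moeb M x) := by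
  have hy : moeb M x * ((M 1 0 : ℝ) * x + M 1 1) = M 0 0 * x + M 0 1 := div_mul_cancel₀ _ h
  simp only [Qval, qslash, Qhom]
  push_cast
  linear_combination (-(q.1 * (moeb M x * ((M 1 0 : ℝ) * x + M 1 1) + (M 0 0 * x + M 0 1)) +
    q.2.1 * ((M 1 0 : ℝ) * x + M 1 1))) * hy

lemma qslash_mem_Qset {M : Mat2} (hM : M.det = 1) {q : QF} (hq : q ∈ Qset) :
    qslash M q ∈ Qset := by
  simpa [Qset, Qdisc_qslash, hM] using hq

lemma IsClassQ1.subset_Qset {B : Set QF} (hB : IsClassQ1 B) : B ⊆ Qset := by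
  obtain ⟨q₀, -, rfl⟩ := hB
  exact fun q hq => hq.1

lemma IsClassQ1.qslash_mem {B : Set QF} (hB : IsClassQ1 B) {M : Mat2} (hM : M.det = 1)
    {q : QF} (hq : q ∈ B) : qslash M q ∈ B := by
  obtain ⟨q₀, -, rfl⟩ := hB
  obtain ⟨hq, N, hN, rfl⟩ := hq
  exact ⟨qslash_mem_Qset hM hq, N * M, by rw [Matrix.det_mul, hN, hM, one_mul],
    qslash_qslash M N q₀⟩

lemma IsClassQ1.exists_Qdisc_eq {B : Set QF} (hB : IsClassQ1 B) :
    ∃ D : ℤ, 0 < D ∧ ∀ q ∈ B, Qdisc q = D := by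
  obtain ⟨q₀, h₀, rfl⟩ := hB
  refine ⟨Qdisc q₀, h₀.1, ?_⟩
  rintro q ⟨-, M, hM, rfl⟩
  simp [Qdisc_qslash, hM]

lemma Qhom_ne_zero_of_coprime {q : QF} (hq : q ∈ Qset) {r t u v : ℤ} (h : r * v - u * t = 1) :
    Qhom q r t ≠ 0 := by
  intro h0
  have hM : (!![r, u; t, v] : Mat2).det = 1 := by simpa [Matrix.det_fin_two] using h
  refine (qslash_mem_Qset hM hq).2 ⟨(qslash !![r, u; t, v] q).2.1, ?_⟩
  have : (qslash !![r, u; t, v] q).1 = 0 := by simpa [qslash] using h0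
  rw [Qdisc, this]
  ring

/-- Numerators of the convergents of the negative continued fraction, starting with `1/0`. -/
def ncfNum (x : ℝ) : ℕ → ℤ
  | 0 => 1
  | 1 => ncfM x 0
  | i + 2 => ncfM x (i + 1) * ncfNum x (i + 1) - ncfNum x i

/-- Denominators of the convergents of the negative continued fraction, starting with `1/0`. -/
def ncfDen (x : ℝ) : ℕ → ℤ
  | 0 => 0
  | 1 => 1
  | i + 2 => ncfM x (i + 1) * ncfDen x (i + 1) - ncfDen x i

/-- The approximation error `p_i - q_i x` of the negative continued fraction. -/
def ncfErr (x : ℝ) (i : ℕ) : ℝ := ncfNum x i - ncfDen x i * x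

/-- The matrix `γ̃_{i+1}`, up to sign, in terms of the convergents. -/
def ncfMat (x : ℝ) (i : ℕ) : Mat2 :=
  !![ncfDen x i, -ncfNum x i; ncfDen x (i + 1), -ncfNum x (i + 1)]

/-- The inverse of `ncfMat x i`. -/
def ncfInv (x : ℝ) (i : ℕ) : Mat2 :=
  !![-ncfNum x (i + 1), ncfNum x i; -ncfDen x (i + 1), ncfDen x i]

lemma ncfNum_mul_ncfDen_sub (x : ℝ) (i : ℕ) :
    ncfNum x i * ncfDen x (i + 1) - ncfNum x (i + 1) * ncfDen x i = 1 := by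
  induction i with
  | zero => simp [ncfNum, ncfDen]
  | succ i ih =>
    simp only [ncfNum, ncfDen]
    linear_combination ih

lemma det_ncfMat (x : ℝ) (i : ℕ) : (ncfMat x i).det = 1 := by
  simp only [ncfMat, Matrix.det_fin_two_of]
  linear_combination ncfNum_mul_ncfDen_sub x i

lemma det_ncfInv (x : ℝ) (i : ℕ) : (ncfInv x i).det = 1 := by
  simp only [ncfInv, Matrix.det_fin_two_of]
  linear_combination ncfNum_mul_ncfDen_sub x i

lemma ncfMat_mul_ncfInv (x : ℝ) (i : ℕ) : ncfMat x i * ncfInv x i = 1 := by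
  have h := ncfNum_mul_ncfDen_sub x i
  ext a b
  fin_cases a <;> fin_cases b <;> simp [ncfMat, ncfInv] <;>
    first | linear_combination h | ring

lemma ncfInv_mul_ncfMat (x : ℝ) (i : ℕ) : ncfInv x i * ncfMat x i = 1 :=
  mul_eq_one_comm.mp (ncfMat_mul_ncfInv x i)

lemma gamt_succ_eq (x : ℝ) (i : ℕ) :
    gamt x (i + 1) = ncfMat x i ∨ gamt x (i + 1) = -ncfMat x i := by
  have step : ∀ i, (MS * Tpow (-(ncfM x (i + 1)))) * ncfMat x i = -ncfMat x (i + 1) := by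
    intro i
    ext a b
    fin_cases a <;> fin_cases b <;> simp [MS, Tpow, ncfMat, ncfNum, ncfDen] <;> ring
  induction i with
  | zero =>
    left
    ext a b
    fin_cases a <;> fin_cases b <;> simp [gamt, MS, Tpow, ncfMat, ncfNum, ncfDen]
  | succ i ih =>
    rw [gamt]
    rcases ih with h | h
    · right; rw [h, step]
    · left; rw [h, mul_neg, step, neg_neg]

lemma qslash_gamt_succ (x : ℝ) (i : ℕ) (q : QF) :
    qslash (gamt x (i + 1)) q = qslash (ncfMat x i) q := by
  rcases gamt_succ_eq x i with h | h <;> rw [h]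
  exact qslash_neg _ _

lemma irrational_ncfX {x : ℝ} (hx : Irrational x) (i : ℕ) : Irrational (ncfX x i) := by
  induction i with
  | zero => exact hx
  | succ i ih =>
    rw [ncfX, one_div]
    exact (ih.intCast_sub _).inv

lemma one_lt_ncfX_succ {x : ℝ} (hx : Irrational x) (i : ℕ) : 1 < ncfX x (i + 1) := by
  have h1 := Int.ceil_lt_add_one (ncfX x i)
  have h2 : ncfX x i < ⌈ncfX x i⌉ :=
    lt_of_le_of_ne (Int.le_ceil _) ((irrational_ncfX hx i).ne_int _)
  rw [ncfX, one_lt_div (by linarith)]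
  linarith

lemma two_le_ncfM_succ {x : ℝ} (hx : Irrational x) (i : ℕ) : 2 ≤ ncfM x (i + 1) := by
  have : (1 : ℤ) < ncfM x (i + 1) := by
    rw [ncfM, Int.lt_ceil]
    exact_mod_cast one_lt_ncfX_succ hx i
  omega

lemma ncfDen_nonneg_and_lt_succ {x : ℝ} (hx : Irrational x) (i : ℕ) :
    0 ≤ ncfDen x i ∧ ncfDen x i < ncfDen x (i + 1) := by
  induction i with
  | zero => simp [ncfDen]
  | succ i ih =>
    refine ⟨by omega, ?_⟩
    rw [ncfDen]
    nlinarith [two_le_ncfM_succ hx i]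

lemma natCast_le_ncfDen {x : ℝ} (hx : Irrational x) (i : ℕ) : (i : ℤ) ≤ ncfDen x i := by
  induction i with
  | zero => simp [ncfDen]
  | succ i ih =>
    have := (ncfDen_nonneg_and_lt_succ hx i).2
    push_cast
    omega

lemma ncfErr_eq_ncfX_mul {x : ℝ} (hx : Irrational x) (i : ℕ) :
    ncfErr x i = ncfX x (i + 1) * ncfErr x (i + 1) := by
  have key : ∀ i, ncfX x (i + 1) * (ncfM x i - ncfX x i) = 1 := by
    intro i
    rw [ncfX, ncfM]
    exact one_div_mul_cancel (sub_ne_zero.mpr ((irrational_ncfX hx i).ne_int _).symm)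
  induction i with
  | zero =>
    have := key 0
    simp only [ncfErr, ncfNum, ncfDen, ncfX] at this ⊢
    push_cast
    linarith
  | succ i ih =>
    have h := key (i + 1)
    have hrec : ncfErr x (i + 2) = ncfM x (i + 1) * ncfErr x (i + 1) - ncfErr x i := by
      simp only [ncfErr, ncfNum, ncfDen]
      push_cast
      ring
    rw [hrec, ih]
    linear_combination -ncfErr x (i + 1) * h

lemma ncfErr_pos {x : ℝ} (hx : Irrational x) (i : ℕ) : 0 < ncfErr x i := by
  induction i with
  | zero => simp [ncfErr, ncfNum, ncfDen]
  | succ i ih =>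
    rw [ncfErr_eq_ncfX_mul hx i] at ih
    exact pos_of_mul_pos_right ih (zero_le_one.trans (one_lt_ncfX_succ hx i).le)

lemma ncfErr_succ_le {x : ℝ} (hx : Irrational x) (i : ℕ) : ncfErr x (i + 1) ≤ ncfErr x i := by
  rw [ncfErr_eq_ncfX_mul hx i]
  exact le_mul_of_one_le_left (ncfErr_pos hx _).le (one_lt_ncfX_succ hx i).le

lemma ncfErr_le_one {x : ℝ} (hx : Irrational x) (i : ℕ) : ncfErr x i ≤ 1 := by
  have := antitone_nat_of_succ_le (ncfErr_succ_le hx) (Nat.zero_le i)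
  simpa [ncfErr, ncfNum, ncfDen] using this

lemma ncfErr_mul_ncfDen_sub (x : ℝ) (i : ℕ) :
    ncfErr x i * ncfDen x (i + 1) - ncfErr x (i + 1) * ncfDen x i = 1 := by
  have h : ((ncfNum x i * ncfDen x (i + 1) - ncfNum x (i + 1) * ncfDen x i : ℤ) : ℝ) = 1 := by
    rw [ncfNum_mul_ncfDen_sub, Int.cast_one]
  push_cast at h
  rw [ncfErr, ncfErr]
  linear_combination h

lemma gamt_succ_denom_ne_zero {x : ℝ} (hx : Irrational x) (i : ℕ) :
    (gamt x (i + 1) 1 0 : ℝ) * x + gamt x (i + 1) 1 1 ≠ 0 := by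
  have := ncfErr_pos hx (i + 1)
  rw [ncfErr] at this
  rcases gamt_succ_eq x i with h | h <;> rw [h] <;> simp [ncfMat] <;> intro h <;> linarith

lemma Qval_qslash_ncfMat (x : ℝ) (i : ℕ) (q : QF) :
    Qval (qslash (ncfMat x i) q) x = q.1 * ncfErr x i ^ 2 +
      q.2.1 * ncfErr x i * ncfErr x (i + 1) + q.2.2 * ncfErr x (i + 1) ^ 2 := by
  simp only [Qval, qslash, Qhom, ncfMat, ncfErr, Matrix.of_apply, Matrix.cons_val', Matrix.cons_val]
  push_cast
  ring

lemma qslash_ncfInv (x : ℝ) (i : ℕ) (q : QF) :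
    (qslash (ncfInv x i) q).1 = Qhom q (ncfNum x (i + 1)) (ncfDen x (i + 1)) ∧
    (qslash (ncfInv x i) q).2.2 = Qhom q (ncfNum x i) (ncfDen x i) := by
  simp [qslash, Qhom, ncfInv]

lemma Qhom_convergent (x : ℝ) (i : ℕ) (q : QF) :
    (Qhom q (ncfNum x i) (ncfDen x i) : ℝ) = (ncfDen x i : ℝ) ^ 2 * Qval q x +
      ncfDen x i * ncfErr x i * (2 * q.1 * x + q.2.1) + q.1 * ncfErr x i ^ 2 := by
  simp only [Qval, Qhom, ncfErr]
  push_cast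
  ring

lemma Qhom_convergent_pos_succ {x : ℝ} (hx : Irrational x) {q : QF} (ha : q.1 < 0)
    (hv : 0 < Qval q x) {i : ℕ} (hi : 0 < Qhom q (ncfNum x i) (ncfDen x i)) :
    0 < Qhom q (ncfNum x (i + 1)) (ncfDen x (i + 1)) := by
  have hi' : (0 : ℝ) < Qhom q (ncfNum x i) (ncfDen x i) := by exact_mod_cast hi
  suffices h : (0 : ℝ) < Qhom q (ncfNum x (i + 1)) (ncfDen x (i + 1)) by exact_mod_cast h
  rw [Qhom_convergent] at hi' ⊢
  have ha' : (q.1 : ℝ) < 0 := by exact_mod_cast ha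
  obtain ⟨h0, h1⟩ := ncfDen_nonneg_and_lt_succ hx i
  have hd := ncfErr_pos hx i
  have he := ncfErr_pos hx (i + 1)
  have hde := ncfErr_succ_le hx i
  have hr0 : (0 : ℝ) ≤ ncfDen x i := by exact_mod_cast h0
  have hr1 : (ncfDen x i : ℝ) < ncfDen x (i + 1) := by exact_mod_cast h1
  generalize ncfErr x i = d at *
  generalize ncfErr x (i + 1) = e at *
  generalize (ncfDen x i : ℝ) = s at *
  generalize (ncfDen x (i + 1) : ℝ) = t at *
  generalize Qval q x = v at *
  generalize (q.1 : ℝ) = a at *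
  generalize 2 * a * x + q.2.1 = w at *
  have hs : s * e < t * d := by nlinarith
  have ht : 0 < t := by linarith
  have key : s * d * (t ^ 2 * v + t * e * w + a * e ^ 2) =
      t * e * (s ^ 2 * v + s * d * w + a * d ^ 2)
        + (t * d - s * e) * (s * t * v - a * d * e) := by ring
  have hs0 : 0 ≤ s * t * v := by positivity
  have hade : 0 < -a * d * e := by
    have : 0 < -a := by linarith
    positivity
  have hR : 0 < s * d * (t ^ 2 * v + t * e * w + a * e ^ 2) := by
    rw [key]
    have h1 : 0 < t * e * (s ^ 2 * v + s * d * w + a * d ^ 2) := by positivity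
    have h2 : 0 < (t * d - s * e) * (s * t * v - a * d * e) :=
      mul_pos (by linarith) (by linarith)
    linarith
  exact pos_of_mul_pos_right hR (by positivity)

lemma exists_Qhom_convergent_pos {x : ℝ} (hx : Irrational x) {q : QF} (hv : 0 < Qval q x) :
    ∃ i, 0 < Qhom q (ncfNum x i) (ncfDen x i) := by
  obtain ⟨n, hn⟩ := exists_nat_gt ((|2 * (q.1 : ℝ) * x + q.2.1| + |(q.1 : ℝ)|) / Qval q x)
  rw [div_lt_iff₀ hv] at hn
  refine ⟨n + 1, ?_⟩
  suffices h : (0 : ℝ) < Qhom q (ncfNum x (n + 1)) (ncfDen x (n + 1)) by exact_mod_cast h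
  rw [Qhom_convergent]
  have hq : ((n + 1 : ℕ) : ℝ) ≤ ncfDen x (n + 1) := by exact_mod_cast natCast_le_ncfDen hx (n + 1)
  have hd := ncfErr_pos hx (n + 1)
  have hd1 := ncfErr_le_one hx (n + 1)
  have hn0 : (0 : ℝ) ≤ n := n.cast_nonneg
  have hw := neg_abs_le (2 * (q.1 : ℝ) * x + q.2.1)
  have hw0 := abs_nonneg (2 * (q.1 : ℝ) * x + q.2.1)
  have ha := neg_abs_le (q.1 : ℝ)
  have ha0 := abs_nonneg (q.1 : ℝ)
  push_cast at hq
  generalize ncfErr x (n + 1) = d at *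
  generalize (ncfDen x (n + 1) : ℝ) = t at *
  generalize |2 * (q.1 : ℝ) * x + q.2.1| = W at *
  generalize 2 * (q.1 : ℝ) * x + q.2.1 = w at *
  generalize |(q.1 : ℝ)| = A at *
  generalize (q.1 : ℝ) = a at *
  have ht1 : 1 ≤ t := by linarith
  have h1 : W + A < t * Qval q x := by nlinarith
  have h2 : -W ≤ d * w := by nlinarith
  have h3 : -A ≤ a * d ^ 2 := by
    have : d ^ 2 ≤ 1 := by nlinarith
    nlinarith [sq_nonneg d]
  have h4 : A < t * (t * Qval q x + d * w) := by nlinarith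
  nlinarith

/-- Every form in `B⟨x⟩` comes from a simple form. -/
lemma exists_qslash_ncfMat_eq {x : ℝ} (hx : Irrational x) {B : Set QF} (hB : IsClassQ1 B)
    {q : QF} (hq : q ∈ QxSet B x) : ∃ Q ∈ QSim B, ∃ i, qslash (ncfMat x i) Q = q := by
  obtain ⟨hqB, ha, hv⟩ := hq
  classical
  have hex := exists_Qhom_convergent_pos hx hv
  obtain ⟨n, hn⟩ : ∃ n, Nat.find hex = n + 1 := by
    refine Nat.exists_eq_succ_of_ne_zero fun h => ?_
    have := Nat.find_spec hex
    rw [h] at this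
    simp [Qhom, ncfNum, ncfDen] at this
    omega
  refine ⟨qslash (ncfInv x n) q, ⟨hB.qslash_mem (det_ncfInv x n) hqB, ?_, ?_⟩, n, ?_⟩
  · rw [(qslash_ncfInv x n q).2]
    refine lt_of_le_of_ne (not_lt.mp (Nat.find_min hex (by omega))) ?_
    exact Qhom_ne_zero_of_coprime (hB.subset_Qset hqB) (ncfNum_mul_ncfDen_sub x n)
  · rw [(qslash_ncfInv x n q).1, ← hn]
    exact Nat.find_spec hex
  · rw [qslash_qslash, ncfInv_mul_ncfMat, qslash_one]

/-- The simple form and the index in `exists_qslash_ncfMat_eq` are unique. -/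
lemma qslash_ncfMat_inj {x : ℝ} (hx : Irrational x) {B : Set QF} {q P Q : QF}
    (hq : q ∈ QxSet B x) (hP : P ∈ QSim B) (hQ : Q ∈ QSim B) {i j : ℕ}
    (hi : qslash (ncfMat x i) P = q) (hj : qslash (ncfMat x j) Q = q) : P = Q ∧ i = j := by
  obtain ⟨-, ha, hv⟩ := hq
  have back : ∀ {P : QF} {i : ℕ}, qslash (ncfMat x i) P = q → P = qslash (ncfInv x i) q := by
    rintro P i rfl
    rw [qslash_qslash, ncfMat_mul_ncfInv, qslash_one]
  have no_lt : ∀ {P Q : QF} {i j : ℕ}, P ∈ QSim B → Q ∈ QSim B → qslash (ncfMat x i) P = q →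
      qslash (ncfMat x j) Q = q → ¬ i < j := by
    intro P Q i j hP hQ hi hj hij
    have h1 := hP.2.2
    have h2 := hQ.2.1
    rw [back hi, (qslash_ncfInv x i q).1] at h1
    rw [back hj, (qslash_ncfInv x j q).2] at h2
    have : 0 < Qhom q (ncfNum x j) (ncfDen x j) :=
      Nat.le_induction (m := i + 1) h1 (fun n _ hn => Qhom_convergent_pos_succ hx ha hv hn) j hij
    exact h2.not_gt this
  have hij : i = j := le_antisymm (not_lt.mp (no_lt hQ hP hj hi)) (not_lt.mp (no_lt hP hQ hi hj))
  exact ⟨by rw [back hi, back hj, hij], hij⟩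

lemma simple_coeff_bounds {B : Set QF} {D : ℤ} (hD : ∀ q ∈ B, Qdisc q = D) {Q : QF}
    (hQ : Q ∈ QSim B) : Q.1 ≤ D ∧ -D ≤ Q.2.1 ∧ Q.2.1 ≤ D ∧ -D ≤ Q.2.2 := by
  obtain ⟨hQB, hc, ha⟩ := hQ
  have h := hD Q hQB
  rw [Qdisc] at h
  refine ⟨?_, ?_, ?_, ?_⟩ <;> nlinarith [sq_nonneg Q.2.1, sq_nonneg (Q.2.1 - 1),
    sq_nonneg (Q.2.1 + 1), mul_pos ha (neg_pos.mpr hc)]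

/-- A nonnegative antitone sequence whose increments control the terms of the sum. -/
def ncfPotential (x : ℝ) (i : ℕ) : ℝ := ncfErr x i ^ 2 + 1 / (1 + ncfDen x i)

lemma ncfPotential_parts {x : ℝ} (hx : Irrational x) (i : ℕ) :
    0 ≤ ncfErr x i ^ 2 - ncfErr x (i + 1) ^ 2 ∧
    0 ≤ 1 / (1 + (ncfDen x i : ℝ)) - 1 / (1 + ncfDen x (i + 1)) := by
  have h0 : (0 : ℝ) ≤ ncfDen x i := by exact_mod_cast (ncfDen_nonneg_and_lt_succ hx i).1
  have h1 : (ncfDen x i : ℝ) < ncfDen x (i + 1) := by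
    exact_mod_cast (ncfDen_nonneg_and_lt_succ hx i).2
  constructor
  · have := pow_le_pow_left₀ (ncfErr_pos hx (i + 1)).le (ncfErr_succ_le hx i) 2
    linarith
  · have := one_div_le_one_div_of_le (by linarith : 0 < 1 + (ncfDen x i : ℝ))
      (by linarith : 1 + (ncfDen x i : ℝ) ≤ 1 + ncfDen x (i + 1))
    linarith

lemma ncfPotential_sub_nonneg {x : ℝ} (hx : Irrational x) (i : ℕ) :
    0 ≤ ncfPotential x i - ncfPotential x (i + 1) := by
  obtain ⟨h1, h2⟩ := ncfPotential_parts hx i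
  rw [ncfPotential, ncfPotential]
  linarith

lemma summable_ncfPotential_sub {x : ℝ} (hx : Irrational x) :
    Summable fun i => ncfPotential x i - ncfPotential x (i + 1) := by
  refine summable_of_sum_range_le (c := ncfPotential x 0) (ncfPotential_sub_nonneg hx) fun n => ?_
  rw [Finset.sum_range_sub']
  have h0 : (0 : ℝ) ≤ ncfDen x n := by exact_mod_cast (ncfDen_nonneg_and_lt_succ hx n).1
  have : 0 ≤ ncfPotential x n := by rw [ncfPotential]; positivity
  linarith

lemma ncfErr_sq_le {x : ℝ} (hx : Irrational x) {B : Set QF} (hB : IsClassQ1 B) {D : ℤ}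
    (hD : ∀ q ∈ B, Qdisc q = D) {Q : QF} (hQ : Q ∈ QSim B) {i : ℕ}
    (hq : qslash (ncfMat x i) Q ∈ QxSet B x) :
    ncfErr x i ^ 2 ≤
      (1 + 3 * D + 54 * D ^ 3) * (ncfPotential x i - ncfPotential x (i + 1)) := by
  obtain ⟨-, hneg, hpos⟩ := hq
  rw [Qval_qslash_ncfMat] at hpos
  have hneg' : Qhom Q (ncfDen x i) (ncfDen x (i + 1)) < 0 := by
    simpa [qslash, ncfMat] using hneg
  obtain ⟨ba, -, bb, -⟩ := simple_coeff_bounds hD hQ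
  have ha : 0 < Q.1 := hQ.2.2
  have hsum : Q.1 + Q.2.1 + Q.2.2 ≠ 0 := by
    have := Qhom_ne_zero_of_coprime (hB.subset_Qset hQ.1) (r := 1) (t := 1) (u := 0) (v := 1)
      (by norm_num)
    simpa [Qhom] using this
  have hne : (Qhom Q (ncfDen x i) (ncfDen x (i + 1)) : ℝ) < 0 := by exact_mod_cast hneg'
  have hd := ncfErr_pos hx i
  have he := ncfErr_pos hx (i + 1)
  have hde := ncfErr_succ_le hx i
  have hdet := ncfErr_mul_ncfDen_sub x i
  have hs0 : (0 : ℝ) ≤ ncfDen x i := by exact_mod_cast (ncfDen_nonneg_and_lt_succ hx i).1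
  have hst : (ncfDen x i : ℝ) + 1 ≤ ncfDen x (i + 1) := by
    exact_mod_cast (ncfDen_nonneg_and_lt_succ hx i).2
  obtain ⟨hp1, hp2⟩ := ncfPotential_parts hx i
  have ha' : (0 : ℝ) < Q.1 := by exact_mod_cast ha
  have ba' : (Q.1 : ℝ) ≤ D := by exact_mod_cast ba
  have bb' : (Q.2.1 : ℝ) ≤ D := by exact_mod_cast bb
  have hD1 : (1 : ℝ) ≤ D := by exact_mod_cast (by omega : (1 : ℤ) ≤ D)
  have hcase : (Q.1 + Q.2.1 + Q.2.2 : ℝ) ≤ -1 ∨ (1 : ℝ) ≤ Q.1 + Q.2.1 + Q.2.2 := by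
    rcases lt_or_gt_of_ne hsum with h | h
    · left; exact_mod_cast (by omega : Q.1 + Q.2.1 + Q.2.2 ≤ -1)
    · right; exact_mod_cast (by omega : 1 ≤ Q.1 + Q.2.1 + Q.2.2)
  simp only [Qhom] at hne
  push_cast at hne
  have hsplit : ncfPotential x i - ncfPotential x (i + 1) =
      (ncfErr x i ^ 2 - ncfErr x (i + 1) ^ 2) +
        (1 / (1 + (ncfDen x i : ℝ)) - 1 / (1 + ncfDen x (i + 1))) := by
    rw [ncfPotential, ncfPotential]
    ring
  rw [hsplit]
  generalize ncfErr x i = d at *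
  generalize ncfErr x (i + 1) = e at *
  generalize (ncfDen x i : ℝ) = s at *
  generalize (ncfDen x (i + 1) : ℝ) = t at *
  generalize (Q.1 : ℝ) = a at *
  generalize (Q.2.1 : ℝ) = b at *
  generalize (Q.2.2 : ℝ) = c at *
  generalize (D : ℝ) = D at *
  have hD3 : 0 ≤ D ^ 3 := by positivity
  rcases hcase with h | h
  · have h1 : e ^ 2 ≤ (d - e) * (a * (d + e) + b * e) := by nlinarith [sq_nonneg e]
    have h2 : a * (d + e) + b * e ≤ 3 * D * d := by nlinarith
    have h3 : e ^ 2 ≤ (d - e) * (3 * D * d) :=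
      h1.trans (mul_le_mul_of_nonneg_left h2 (by linarith))
    have h4 : (d - e) * (3 * D * d) ≤ 3 * D * (d ^ 2 - e ^ 2) := by
      have : 0 ≤ D * ((d - e) * e) := mul_nonneg (by linarith) (mul_nonneg (by linarith) he.le)
      nlinarith
    calc d ^ 2 ≤ (1 + 3 * D) * (d ^ 2 - e ^ 2) := by linarith
      _ ≤ _ := mul_le_mul (by linarith) (by linarith) hp1 (by positivity)
  · have ht : 0 < t := by linarith
    have h1 : t ^ 2 ≤ (t - s) * (a * (t + s) + b * t) := by nlinarith [sq_nonneg t]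
    have h2 : a * (t + s) + b * t ≤ 3 * D * t := by nlinarith
    have h3 : t ^ 2 ≤ (t - s) * (3 * D * t) :=
      h1.trans (mul_le_mul_of_nonneg_left h2 (by linarith))
    have h4 : t ≤ 3 * D * (t - s) := by nlinarith
    have h5 : d * (t - s) ≤ 1 := by nlinarith
    have h6 : (d * (t - s)) ^ 2 ≤ 1 := pow_le_one₀ (mul_nonneg hd.le (by linarith)) h5
    have h7 : t ^ 3 ≤ (3 * D * (t - s)) ^ 3 := pow_le_pow_left₀ ht.le h4 3
    have hts : 0 < t - s := by linarith
    have h8 : d ^ 2 * t ^ 2 ≤ 27 * D ^ 3 * (t - s) := by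
      calc d ^ 2 * t ^ 2 ≤ d ^ 2 * t ^ 3 := by
            have : t ^ 2 ≤ t ^ 3 := pow_le_pow_right₀ (by linarith) (by norm_num)
            gcongr
        _ ≤ d ^ 2 * (3 * D * (t - s)) ^ 3 := by gcongr
        _ = 27 * D ^ 3 * (t - s) * (d * (t - s)) ^ 2 := by ring
        _ ≤ 27 * D ^ 3 * (t - s) * 1 := by gcongr
        _ = _ := by ring
    have h9 : d ^ 2 ≤ 54 * D ^ 3 * (1 / (1 + s) - 1 / (1 + t)) := by
      have hs1 : 0 < 1 + s := by linarith
      have ht1 : 0 < 1 + t := by linarith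
      rw [div_sub_div _ _ hs1.ne' ht1.ne', mul_div_assoc', le_div_iff₀ (mul_pos hs1 ht1)]
      have : (1 + s) * (1 + t) ≤ 2 * t ^ 2 := by nlinarith
      calc d ^ 2 * ((1 + s) * (1 + t)) ≤ d ^ 2 * (2 * t ^ 2) := by gcongr
        _ ≤ _ := by linarith
    refine h9.trans (mul_le_mul (by linarith) (by linarith) hp2 (by positivity))

lemma summable_Qval_QxSet {x : ℝ} (hx : Irrational x) {B : Set QF} (hB : IsClassQ1 B) :
    Summable fun q : ↥(QxSet B x) => Qval q.1 x := by
  obtain ⟨D, hD0, hD⟩ := hB.exists_Qdisc_eq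
  choose F hF idx hidx using fun q : ↥(QxSet B x) => exists_qslash_ncfMat_eq hx hB q.2
  have hbox : ∀ q, F q ∈ Finset.Icc 0 D ×ˢ Finset.Icc (-D) D ×ˢ Finset.Icc (-D) D := by
    intro q
    obtain ⟨h1, h2, h3, h4⟩ := simple_coeff_bounds hD (hF q)
    have h5 := (hF q).2.1
    have h6 := (hF q).2.2
    simp only [Finset.mem_product, Finset.mem_Icc]
    omega
  let φ : ↥(QxSet B x) → ↥(Finset.Icc 0 D ×ˢ Finset.Icc (-D) D ×ˢ Finset.Icc (-D) D) × ℕ :=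
    fun q => (⟨F q, hbox q⟩, idx q)
  have hφ : Function.Injective φ := by
    intro p q h
    simp only [φ, Prod.mk.injEq, Subtype.mk.injEq] at h
    exact Subtype.ext (by rw [← hidx p, ← hidx q, h.1, h.2])
  have hsum := (Summable.mul_of_nonneg
    (f := fun _ : ↥(Finset.Icc 0 D ×ˢ Finset.Icc (-D) D ×ˢ Finset.Icc (-D) D) =>
      2 * (D : ℝ) * (1 + 3 * D + 54 * D ^ 3))
    (Summable.of_finite) (summable_ncfPotential_sub hx)
    (fun _ => by
      have : (0 : ℝ) < D := by exact_mod_cast hD0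
      positivity)
    (ncfPotential_sub_nonneg hx)).comp_injective hφ
  refine Summable.of_nonneg_of_le (fun q => q.2.2.2.le) (fun q => ?_) hsum
  have hmem : qslash (ncfMat x (idx q)) (F q) ∈ QxSet B x := by
    rw [hidx q]
    exact q.2
  have h1 := ncfErr_sq_le hx hB hD (hF q) hmem
  obtain ⟨ba, -, bb, -⟩ := simple_coeff_bounds hD (hF q)
  have ba' : ((F q).1 : ℝ) ≤ D := by exact_mod_cast ba
  have bb' : ((F q).2.1 : ℝ) ≤ D := by exact_mod_cast bb
  have hc : ((F q).2.2 : ℝ) < 0 := by exact_mod_cast (hF q).2.1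
  have hD' : (0 : ℝ) < D := by exact_mod_cast hD0
  have hd := ncfErr_pos hx (idx q)
  have he := ncfErr_pos hx (idx q + 1)
  have hde := ncfErr_succ_le hx (idx q)
  calc Qval q.1 x = Qval (qslash (ncfMat x (idx q)) (F q)) x := by rw [hidx q]
    _ ≤ 2 * D * ncfErr x (idx q) ^ 2 := by
      rw [Qval_qslash_ncfMat]
      have t1 : ((F q).1 : ℝ) * ncfErr x (idx q) ^ 2 ≤ D * ncfErr x (idx q) ^ 2 := by gcongr
      have t2 : ((F q).2.1 : ℝ) * ncfErr x (idx q) * ncfErr x (idx q + 1) ≤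
          D * ncfErr x (idx q) ^ 2 := by
        calc ((F q).2.1 : ℝ) * ncfErr x (idx q) * ncfErr x (idx q + 1)
            ≤ D * ncfErr x (idx q) * ncfErr x (idx q + 1) := by gcongr
          _ ≤ D * ncfErr x (idx q) * ncfErr x (idx q) := by gcongr
          _ = _ := by ring
      have t3 : ((F q).2.2 : ℝ) * ncfErr x (idx q + 1) ^ 2 ≤ 0 :=
        mul_nonpos_of_nonpos_of_nonneg hc.le (sq_nonneg _)
      linarith
    _ ≤ 2 * D * ((1 + 3 * D + 54 * D ^ 3) *
          (ncfPotential x (idx q) - ncfPotential x (idx q + 1))) := by gcongr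
    _ = _ := by simp only [Function.comp_apply, φ]; ring

lemma Summable.pow_of_nonneg {ι : Type*} {f : ι → ℝ} (hf : Summable f) (h0 : ∀ i, 0 ≤ f i)
    {n : ℕ} (hn : n ≠ 0) : Summable fun i => f i ^ n := by
  obtain ⟨m, rfl⟩ := Nat.exists_eq_succ_of_ne_zero hn
  refine Summable.of_nonneg_of_le (fun i => pow_nonneg (h0 i) _) (fun i => ?_)
    (hf.mul_left ((∑' j, f j) ^ m))
  rw [pow_succ]
  exact mul_le_mul_of_nonneg_right
    (pow_le_pow_left₀ (h0 i) (hf.le_tsum i fun j _ => h0 j) m) (h0 i)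

lemma qslash_mem_QxSet_iff {x : ℝ} (hx : Irrational x) {B : Set QF} (hB : IsClassQ1 B)
    {Q : QF} (hQ : Q ∈ B) (i : ℕ) :
    qslash (gamt x (i + 1)) Q ∈ QxSet B x ↔ 0 < Qval Q (moeb (gamt x (i + 1)) x) ∧
      Qhom Q (gamt x (i + 1) 0 0) (gamt x (i + 1) 1 0) < 0 := by
  have hB' : qslash (gamt x (i + 1)) Q ∈ B := by
    rw [qslash_gamt_succ]
    exact hB.qslash_mem (det_ncfMat x i) hQ
  have hden := gamt_succ_denom_ne_zero hx i
  have hval := Qval_qslash _ Q hden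
  rw [QxSet, Set.mem_sep_iff, hval, mul_pos_iff_of_pos_left (by positivity)]
  exact ⟨fun h => ⟨h.2.2, h.2.1⟩, fun h => ⟨hB', h.2, h.1⟩⟩

lemma exists_eq_gamt_succ {x : ℝ} {M : Mat2} (hM : M ∈ Gamma1Set x) :
    ∃ i, M = gamt x (i + 1) := by
  obtain ⟨i, hi, rfl⟩ := hM
  exact ⟨i - 1, by rw [Nat.sub_add_cancel hi]⟩

lemma exists_equiv_Sim1Pairs_QxSet {x : ℝ} (hx : Irrational x) {B : Set QF} (hB : IsClassQ1 B) :
    ∃ e : ↥(Sim1Pairs B x) ≃ ↥(QxSet B x), ∀ pg, (e pg).1 = qslash pg.1.2 pg.1.1 := by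
  have hmem : ∀ pg : ↥(Sim1Pairs B x), qslash pg.1.2 pg.1.1 ∈ QxSet B x := by
    rintro ⟨⟨Q, M⟩, hQ, hM, h⟩
    obtain ⟨i, rfl⟩ := exists_eq_gamt_succ hM
    exact (qslash_mem_QxSet_iff hx hB hQ.1 i).mpr h
  refine ⟨Equiv.ofBijective (fun pg => ⟨qslash pg.1.2 pg.1.1, hmem pg⟩) ⟨?_, ?_⟩, fun _ => rfl⟩
  · rintro ⟨⟨P, M⟩, hP, hM, hP'⟩ ⟨⟨Q, N⟩, hQ, hN, hQ'⟩ h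
    obtain ⟨i, rfl⟩ := exists_eq_gamt_succ hM
    obtain ⟨j, rfl⟩ := exists_eq_gamt_succ hN
    have h' : qslash (gamt x (i + 1)) P = qslash (gamt x (j + 1)) Q := congrArg Subtype.val h
    have hq := (qslash_mem_QxSet_iff hx hB hP.1 i).mpr hP'
    obtain ⟨rfl, rfl⟩ := qslash_ncfMat_inj hx hq hP hQ (qslash_gamt_succ x i P).symm
      ((qslash_gamt_succ x j Q).symm.trans h'.symm)
    rfl
  · rintro ⟨q, hq⟩
    obtain ⟨Q, hQ, i, rfl⟩ := exists_qslash_ncfMat_eq hx hB hq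
    rw [← qslash_gamt_succ] at hq
    exact ⟨⟨(Q, gamt x (i + 1)), hQ, ⟨i + 1, by omega, rfl⟩,
      (qslash_mem_QxSet_iff hx hB hQ.1 i).mp hq⟩, Subtype.ext (qslash_gamt_succ x i Q)⟩

/-- **Corollary of Theorem 5.** For irrational `x`, `k ≥ 2` and a
`Γ₁`-equivalence class `B` in `𝒬`:
`∑_{Q ∈ B⟨x⟩} Q(x)^{k-1} = ∑_{Q ∈ B^Sim} ∑_{γ ∈ Γ₁(x), Q(γ(x))>0, Q(γ(∞))<0} (Q|γ)(x)^{k-1}`. -/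
theorem stmt11 (x : ℝ) (hx : Irrational x) (k : ℕ) (hk : 2 ≤ k)
    (B : Set QF) (hB : IsClassQ1 B) :
    Summable (fun q : ↥(QxSet B x) => Qval q.1 x ^ (k - 1)) ∧
    Summable (fun pg : ↥(Sim1Pairs B x) => Qval (qslash pg.1.2 pg.1.1) x ^ (k - 1)) ∧
    (∑' q : ↥(QxSet B x), Qval q.1 x ^ (k - 1)) =
      (∑' pg : ↥(Sim1Pairs B x), Qval (qslash pg.1.2 pg.1.1) x ^ (k - 1)) := by
  have hs : Summable fun q : ↥(QxSet B x) => Qval q.1 x ^ (k - 1) :=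
    (summable_Qval_QxSet hx hB).pow_of_nonneg (fun q => q.2.2.2.le) (by omega)
  obtain ⟨e, he⟩ := exists_equiv_Sim1Pairs_QxSet hx hB
  have hcomp : (fun pg : ↥(Sim1Pairs B x) => Qval (qslash pg.1.2 pg.1.1) x ^ (k - 1)) =
      (fun q : ↥(QxSet B x) => Qval q.1 x ^ (k - 1)) ∘ e := by
    funext pg
    simp [he]
  rw [hcomp]
  exact ⟨hs, e.summable_iff.mpr hs,
    (e.tsum_eq fun q : ↥(QxSet B x) => Qval q.1 x ^ (k - 1)).symm⟩
end
end

section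
/- Let k ≥ 1 and let P ∈ ℂ[X] have degree ≤ 2k. For every irrational real number x, the sum defining P^Γ(x) converges absolutely and P^Γ(x+1) = P^Γ(x). -/
open Polynomial Matrix

noncomputable section

lemma Irrational.cfX {x : ℝ} (hx : Irrational x) (i : ℕ) : Irrational (cfX x i) := by
  induction i with
  | zero => exact hx
  | succ i ih =>
    simp only [_root_.cfX, one_div]
    exact (ih.sub_intCast _).inv

lemma cfX_add_one (x : ℝ) (i : ℕ) : cfX (x + 1) (i + 1) = cfX x (i + 1) := by
  induction i with
  | zero => simp [cfX]
  | succ i ih => rw [cfX, ih, ← cfX]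

lemma gam_add_one (x : ℝ) (i : ℕ) : gam (x + 1) (i + 1) = gam x (i + 1) * Tpow (-1) := by
  induction i with
  | zero =>
    ext a b
    fin_cases a <;> fin_cases b <;>
      simp [gam, cfN, cfX, Meps, Tpow, Matrix.mul_apply, Fin.sum_univ_two]
  | succ i ih =>
    rw [gam, ih, cfN, cfX_add_one, ← cfN, ← Matrix.mul_assoc, ← gam]

lemma gam_succ_zero (x : ℝ) (i : ℕ) (b : Fin 2) : gam x (i + 1) 0 b = gam x i 1 b := by
  simp [gam, Meps, Tpow, Matrix.mul_apply, Fin.sum_univ_two]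

lemma gam_succ_one (x : ℝ) (i : ℕ) (b : Fin 2) :
    gam x (i + 1) 1 b = gam x i 0 b - cfN x i * gam x i 1 b := by
  simp [gam, Meps, Tpow, Matrix.mul_apply, Fin.sum_univ_two]
  ring

/-- The automorphy factor `t x + u` of `γ_i = [[r,s],[t,u]]` at `x`. -/
def gamDenom (x : ℝ) (i : ℕ) : ℝ := (gam x i 1 0 : ℝ) * x + (gam x i 1 1 : ℝ)

lemma gamDenom_succ_succ (x : ℝ) (i : ℕ) :
    gamDenom x (i + 2) = gamDenom x i - cfN x (i + 1) * gamDenom x (i + 1) := by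
  simp only [gamDenom, gam_succ_one x (i + 1), gam_succ_zero x i]
  push_cast
  ring

lemma gam_num_eq (x : ℝ) (i : ℕ) :
    (gam x (i + 1) 0 0 : ℝ) * x + (gam x (i + 1) 0 1 : ℝ) = gamDenom x i := by
  simp only [gamDenom, gam_succ_zero]

lemma gamDenom_succ {x : ℝ} (hx : Irrational x) (i : ℕ) :
    gamDenom x (i + 1) = gamDenom x i * Int.fract (cfX x i) := by
  induction i with
  | zero => simp [gamDenom, gam, cfN, cfX, Meps, Tpow, Matrix.mul_apply, Fin.sum_univ_two,
      Int.fract, sub_eq_add_neg]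
  | succ i ih =>
    have hne : Int.fract (cfX x i) ≠ 0 := by
      rw [Int.fract]
      exact ((hx.cfX i).sub_intCast _).ne_zero
    have h : gamDenom x i = gamDenom x (i + 1) * cfX x (i + 1) := by
      rw [ih, cfX, ← Int.fract]
      field_simp
    rw [gamDenom_succ_succ, h, Int.fract, cfN]
    ring

lemma Irrational.fract_pos {y : ℝ} (hy : Irrational y) : 0 < Int.fract y :=
  lt_of_le_of_ne (Int.fract_nonneg y) (hy.sub_intCast _).ne_zero.symm

lemma gamDenom_pos {x : ℝ} (hx : Irrational x) (i : ℕ) : 0 < gamDenom x i := by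
  induction i with
  | zero => simp [gamDenom, gam]
  | succ i ih =>
    rw [gamDenom_succ hx]
    exact mul_pos ih (hx.cfX i).fract_pos

lemma gamDenom_succ_le {x : ℝ} (hx : Irrational x) (i : ℕ) :
    gamDenom x (i + 1) ≤ gamDenom x i := by
  rw [gamDenom_succ hx]
  exact mul_le_of_le_one_right (gamDenom_pos hx i).le (Int.fract_lt_one _).le

lemma gamDenom_le_one {x : ℝ} (hx : Irrational x) (i : ℕ) : gamDenom x i ≤ 1 := by
  induction i with
  | zero => simp [gamDenom, gam]
  | succ i ih => exact (gamDenom_succ_le hx i).trans ih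

lemma one_le_cfN_succ {x : ℝ} (hx : Irrational x) (i : ℕ) : 1 ≤ cfN x (i + 1) := by
  rw [cfN, Int.le_floor, cfX, ← Int.fract, Int.cast_one]
  exact one_le_one_div (hx.cfX i).fract_pos (Int.fract_lt_one _).le

lemma gamDenom_add_le {x : ℝ} (hx : Irrational x) (i : ℕ) :
    gamDenom x (i + 1) + gamDenom x (i + 2) ≤ gamDenom x i := by
  have h : (1 : ℝ) ≤ cfN x (i + 1) := by exact_mod_cast one_le_cfN_succ hx i
  rw [gamDenom_succ_succ]
  nlinarith [gamDenom_pos hx (i + 1)]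

lemma summable_gamDenom {x : ℝ} (hx : Irrational x) : Summable (gamDenom x) := by
  have key (n : ℕ) : ∑ i ∈ Finset.range n, gamDenom x (i + 1) ≤
      gamDenom x 0 + gamDenom x 1 - gamDenom x n - gamDenom x (n + 1) := by
    induction n with
    | zero => simp
    | succ n ih =>
      rw [Finset.sum_range_succ]
      linarith [gamDenom_add_le hx n]
  rw [← summable_nat_add_iff 1]
  refine summable_of_sum_range_le (c := gamDenom x 0 + gamDenom x 1)
    (fun i => (gamDenom_pos hx _).le) fun n => ?_
  linarith [key n, gamDenom_pos hx n, gamDenom_pos hx (n + 1)]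

lemma eval_cslash (d : ℕ) (M : Mat2) (P : Polynomial ℂ) (z : ℂ) :
    (cslash d M P).eval z = ∑ j ∈ Finset.range (d + 1),
      P.coeff j * (M 0 0 * z + M 0 1) ^ j * (M 1 0 * z + M 1 1) ^ (d - j) := by
  simp [cslash, eval_finsetSum]

lemma eval_cslash_mul_Tpow (d : ℕ) (M : Mat2) (P : Polynomial ℂ) (n : ℤ) (z : ℂ) :
    (cslash d (M * Tpow n) P).eval z = (cslash d M P).eval (z + n) := by
  have h (a : Fin 2) : ((M * Tpow n) a 0 : ℂ) * z + ((M * Tpow n) a 1 : ℂ) =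
      M a 0 * (z + n) + M a 1 := by
    simp [Tpow, Matrix.mul_apply, Fin.sum_univ_two]
    ring
  simp only [eval_cslash, h]

lemma norm_eval_cslash_gam_le {x : ℝ} (hx : Irrational x) {d : ℕ} (hd : 1 ≤ d)
    (P : Polynomial ℂ) (i : ℕ) :
    ‖(cslash d (gam x (i + 1)) P).eval (x : ℂ)‖ ≤
      (∑ j ∈ Finset.range (d + 1), ‖P.coeff j‖) * gamDenom x i := by
  have h0 : (gam x (i + 1) 0 0 : ℂ) * x + gam x (i + 1) 0 1 = (gamDenom x i : ℝ) := by
    rw [← gam_num_eq]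
    push_cast
    rfl
  have h1 : (gam x (i + 1) 1 0 : ℂ) * x + gam x (i + 1) 1 1 = (gamDenom x (i + 1) : ℝ) := by
    rw [gamDenom]
    push_cast
    rfl
  have hp := gamDenom_pos hx i
  have hp' := gamDenom_pos hx (i + 1)
  rw [eval_cslash, Finset.sum_mul, h0, h1]
  refine norm_sum_le_of_le _ fun j hj => ?_
  rw [norm_mul, norm_mul, norm_pow, norm_pow, Complex.norm_real, Complex.norm_real,
    Real.norm_of_nonneg hp.le, Real.norm_of_nonneg hp'.le, mul_assoc]
  refine mul_le_mul_of_nonneg_left ?_ (norm_nonneg _)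
  calc gamDenom x i ^ j * gamDenom x (i + 1) ^ (d - j)
      ≤ gamDenom x i ^ j * gamDenom x i ^ (d - j) := by
        gcongr
        exact gamDenom_succ_le hx i
    _ = gamDenom x i ^ d := by
        rw [← pow_add, Nat.add_sub_cancel' (Finset.mem_range_succ_iff.mp hj)]
    _ ≤ gamDenom x i := pow_le_of_le_one hp.le (gamDenom_le_one hx i) (by omega)

lemma summable_norm_eval_cslash {x : ℝ} (hx : Irrational x) {d : ℕ} (hd : 1 ≤ d)
    (P : Polynomial ℂ) :
    Summable (fun γ : GammaSet x => ‖(cslash d γ.1 P).eval (x : ℂ)‖) := by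
  have hs : Summable fun i => ‖(cslash d (gam x (i + 1)) P).eval (x : ℂ)‖ :=
    ((summable_gamDenom hx).mul_left _).of_nonneg_of_le (fun _ => norm_nonneg _)
      (norm_eval_cslash_gam_le hx hd P)
  have hg (γ : GammaSet x) : ∃ i, γ.1 = gam x (i + 1) := by
    obtain ⟨i, hi, h⟩ := γ.2
    exact ⟨i - 1, by rwa [Nat.sub_add_cancel hi]⟩
  choose g hg using hg
  have hinj : Function.Injective g := fun a b hab => Subtype.ext (by rw [hg a, hg b, hab])
  exact (hs.comp_injective hinj).congr fun γ => by simp only [Function.comp_apply, ← hg γ]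

lemma mul_Tpow_mul_Tpow_neg (M : Mat2) (n : ℤ) : M * Tpow n * Tpow (-n) = M := by
  have h : Tpow n * Tpow (-n) = 1 := by
    ext a b
    fin_cases a <;> fin_cases b <;> simp [Tpow, Matrix.mul_apply, Fin.sum_univ_two]
  rw [Matrix.mul_assoc, h, Matrix.mul_one]

/-- The bijection `Γ(x) ≃ Γ(x+1)`, `γ ↦ γ T⁻¹`. -/
def gammaSetEquivAddOne (x : ℝ) : GammaSet x ≃ GammaSet (x + 1) where
  toFun γ := ⟨γ.1 * Tpow (-1), by
    obtain ⟨i, hi, h⟩ := γ.2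
    obtain ⟨i, rfl⟩ := Nat.exists_eq_add_of_le' hi
    exact ⟨i + 1, hi, by rw [h, gam_add_one]⟩⟩
  invFun γ := ⟨γ.1 * Tpow 1, by
    obtain ⟨i, hi, h⟩ := γ.2
    obtain ⟨i, rfl⟩ := Nat.exists_eq_add_of_le' hi
    refine ⟨i + 1, hi, ?_⟩
    simpa [h, gam_add_one] using mul_Tpow_mul_Tpow_neg (gam x (i + 1)) (-1)⟩
  left_inv γ := Subtype.ext <| by simpa using mul_Tpow_mul_Tpow_neg γ.1 (-1)
  right_inv γ := Subtype.ext <| mul_Tpow_mul_Tpow_neg γ.1 1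

lemma PGam_add_one (k : ℕ) (P : Polynomial ℂ) (x : ℝ) : PGam k P (x + 1) = PGam k P x := by
  refine ((gammaSetEquivAddOne x).tsum_eq _).symm.trans (tsum_congr fun γ => ?_)
  simp [gammaSetEquivAddOne, eval_cslash_mul_Tpow]

/-- **Theorem 6(i).** For `k ≥ 1`, `P ∈ ℂ[X]` of degree ≤ 2k, and `x`
irrational, the sum defining `P^Γ(x)` converges absolutely, and `P^Γ(x+1) = P^Γ(x)`. -/
theorem stmt12 (k : ℕ) (hk : 1 ≤ k) (P : Polynomial ℂ) (hP : P.natDegree ≤ 2 * k)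
    (x : ℝ) (hx : Irrational x) :
    Summable (fun γ : ↥(GammaSet x) => ‖Polynomial.eval (x : ℂ) (cslash (2 * k) γ.1 P)‖) ∧
    PGam k P (x + 1) = PGam k P x := by
  exact ⟨summable_norm_eval_cslash hx (by omega) P, PGam_add_one k P x⟩
end
end
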